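/- For every real R > 1 the following hold: (i) for all integers k, ℓ with k ≥ 0 or ℓ ≥ 0 one has S̃_R(k,ℓ) = 0; (ii) S̃_R(-1,-1) = 1/a. (These are the identities showing that the whole-plane solid coupling function S built from S̃ vanishes off the frozen pattern and takes the value corresponding to a brick-wall dimer configuration.) -/

import Mathlib

/-- `c = a/(1+a²)`. -/
noncomputable def cOf (a : ℝ) : ℝ := a / (1 + a ^ 2)

/-- The branch of the logarithm with argument in `(-π/2, 3π/2]`:
`L(z) = Log(-iz) + iπ/2` where `Log` is the principal branch. -/
noncomputable def Lbr (z : ℂ) : ℂ :=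
  Complex.log (-Complex.I * z) + Complex.I * ((Real.pi : ℂ) / 2)

/-- The branch `√(ω² + 2c) = exp((1/2)L(ω + i√(2c)) + (1/2)L(ω - i√(2c)))`. -/
noncomputable def sqBr (a : ℝ) (ω : ℂ) : ℂ :=
  Complex.exp ((1 / 2 : ℂ) * Lbr (ω + Complex.I * (Real.sqrt (2 * cOf a) : ℂ)) +
    (1 / 2 : ℂ) * Lbr (ω - Complex.I * (Real.sqrt (2 * cOf a) : ℂ)))

/-- `G(ω) = (ω - √(ω² + 2c))/√(2c)`. -/
noncomputable def Gbr (a : ℝ) (ω : ℂ) : ℂ :=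
  (ω - sqBr a ω) / (Real.sqrt (2 * cOf a) : ℂ)

/-- The branch cuts `𝒞 = i·((-∞, -1/√(2c)] ∪ [-√(2c), √(2c)] ∪ [1/√(2c), ∞))`. -/
def cuts (a : ℝ) : Set ℂ :=
  {z : ℂ | ∃ t : ℝ, z = Complex.I * (t : ℂ) ∧
    (t ≤ -(1 / Real.sqrt (2 * cOf a)) ∨
      (-Real.sqrt (2 * cOf a) ≤ t ∧ t ≤ Real.sqrt (2 * cOf a)) ∨
      1 / Real.sqrt (2 * cOf a) ≤ t)}

/-- `S̃_R(k,ℓ)`, the double contour integral over `|ω₁| = |ω₂| = R` defining the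
whole-plane solid coupling function. -/
noncomputable def Stilde (a R : ℝ) (k l : ℤ) : ℂ :=
  Complex.I ^ (-k - l) * (2 * (1 + (a : ℂ) ^ 2))⁻¹ *
    ((2 * (Real.pi : ℂ) * Complex.I) ^ 2)⁻¹ *
    ∮ ω₁ in C(0, R), ∮ ω₂ in C(0, R),
      Gbr a ω₁ ^ l * Gbr a ω₂ ^ k / ((1 - ω₁ * ω₂) * sqBr a ω₁ * sqBr a ω₂)

open Complex Filter Topology Bornology

/-- The residue at infinity of a function holomorphic outside a disc is read off from the limit of
`z * h z`. -/
lemma circleIntegral_eq_of_tendsto_mul_cobounded {h : ℂ → ℂ} {R : ℝ} {A : ℂ} (hR : 0 < R)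
    (hd : ∀ z, R ≤ ‖z‖ → DifferentiableAt ℂ h z)
    (hA : Tendsto (fun z => z * h z) (cobounded ℂ) (𝓝 A)) :
    (∮ z in C(0, R), h z) = 2 * Real.pi * I * A := by
  refine eq_of_sub_eq_zero (norm_le_zero_iff.1 (le_of_forall_pos_le_add fun ε hε => ?_))
  have hpi := Real.pi_pos
  obtain ⟨M, -, hM⟩ := hasBasis_cobounded_norm.eventually_iff.1
    (Metric.tendsto_nhds.1 hA (ε / (2 * Real.pi)) (by positivity))
  set r := max M R
  have hRr : R ≤ r := le_max_right M R
  have hr : 0 < r := hR.trans_le hRr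
  have hmem {z : ℂ} (hz : z ∈ Metric.sphere (0 : ℂ) r) : ‖z‖ = r := by simpa using hz
  have heq : (∮ z in C(0, R), h z) = ∮ z in C(0, r), h z := by
    refine (circleIntegral_eq_of_differentiable_on_annulus_off_countable hR hRr
      Set.countable_empty (fun z hz => ?_) fun z hz => ?_).symm
    · exact (hd z (by simpa using hz.2)).continuousAt.continuousWithinAt
    · exact hd z (le_of_lt (by simpa using hz.1.2))
  have hinv : (∮ z in C(0, r), A * (z - 0)⁻¹) = 2 * Real.pi * I * A := by
    rw [circleIntegral.integral_const_mul, circleIntegral.integral_sub_center_inv 0 hr.ne']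
    ring
  rw [heq, ← hinv, ← circleIntegral.integral_sub]
  · refine (circleIntegral.norm_integral_le_of_norm_le_const hr.le (C := ε / (2 * Real.pi) / r)
      fun z hz => ?_).trans (le_of_eq ?_)
    · have hz0 : z ≠ 0 := norm_pos_iff.1 (by rw [hmem hz]; exact hr)
      have hb := hM (x := z) (by simp [hmem hz, r])
      rw [dist_eq_norm] at hb
      rw [le_div_iff₀ hr, ← hmem hz, ← norm_mul]
      refine le_of_eq_of_le ?_ hb.le
      congr 1
      field_simp
      ring
    · field_simp
      ring
  · exact ContinuousOn.circleIntegrable hr.le fun z hz =>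
      (hd z (hRr.trans (hmem hz).ge)).continuousAt.continuousWithinAt
  · refine ContinuousOn.circleIntegrable hr.le fun z hz => ContinuousAt.continuousWithinAt ?_
    have hz0 : z ≠ 0 := norm_pos_iff.1 (by rw [hmem hz]; exact hr)
    exact continuousAt_const.mul ((continuousAt_id.sub continuousAt_const).inv₀ (by simpa using hz0))

/-- Fubini for continuous integrands on a torus. -/
lemma circleIntegral_swap {f : ℂ → ℂ → ℂ} {R : ℝ} (hR : 0 ≤ R)
    (hf : ContinuousOn (Function.uncurry f) (Metric.sphere 0 R ×ˢ Metric.sphere 0 R)) :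
    (∮ z in C(0, R), ∮ w in C(0, R), f z w) = ∮ w in C(0, R), ∮ z in C(0, R), f z w := by
  have hcont : Continuous fun p : ℝ × ℝ => f (circleMap 0 R p.1) (circleMap 0 R p.2) := by
    have := hf.comp_continuous (f := fun p : ℝ × ℝ => (circleMap 0 R p.1, circleMap 0 R p.2))
      (by fun_prop) fun p => ⟨circleMap_mem_sphere 0 hR _, circleMap_mem_sphere 0 hR _⟩
    exact this
  simp only [circleIntegral, deriv_circleMap, smul_eq_mul, ← intervalIntegral.integral_const_mul]
  rw [MeasureTheory.intervalIntegral_intervalIntegral_swap]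
  · refine intervalIntegral.integral_congr fun x _ => intervalIntegral.integral_congr fun y _ => ?_
    ring
  · refine MeasureTheory.IntegrableOn.mono_set ?_
      (Set.prod_mono Set.uIoc_subset_uIcc Set.uIoc_subset_uIcc)
    refine ContinuousOn.integrableOn_compact (isCompact_uIcc.prod isCompact_uIcc) ?_
    refine Continuous.continuousOn ?_
    have h1 : Continuous fun p : ℝ × ℝ => circleMap 0 R p.1 := by fun_prop
    have h2 : Continuous fun p : ℝ × ℝ => circleMap 0 R p.2 := by fun_prop
    exact (h1.mul continuous_const).mul ((h2.mul continuous_const).mul hcont)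

lemma abs_arg_add_sub_arg_sub_lt_pi {w : ℂ} {s : ℝ} (hs : 0 ≤ s) (hw : s < ‖w‖) :
    |(w + s).arg - (w - s).arg| < Real.pi := by
  have hpi := Real.pi_pos
  rcases lt_trichotomy w.im 0 with h | h | h
  · have h1 := arg_neg_iff.2 (show (w + s).im < 0 by simpa using h)
    have h2 := arg_neg_iff.2 (show (w - s).im < 0 by simpa using h)
    have h3 := neg_pi_lt_arg (w + s)
    have h4 := neg_pi_lt_arg (w - s)
    rw [abs_lt]
    constructor <;> linarith
  · obtain ⟨x, rfl⟩ : ∃ x : ℝ, w = x := ⟨w.re, Complex.ext (by simp) (by simpa using h)⟩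
    rw [norm_real, Real.norm_eq_abs] at hw
    rw [← ofReal_add, ← ofReal_sub]
    rcases lt_abs.1 hw with h | h
    · rw [arg_ofReal_of_nonneg (by linarith), arg_ofReal_of_nonneg (by linarith)]
      simpa using hpi
    · rw [arg_ofReal_of_neg (by linarith), arg_ofReal_of_neg (by linarith)]
      simpa using hpi
  · have h1 := arg_nonneg_iff.2 (show 0 ≤ (w + s).im by simpa using h.le)
    have h2 := arg_nonneg_iff.2 (show 0 ≤ (w - s).im by simpa using h.le)
    have h3 := arg_lt_pi_iff.2 (Or.inr (show (w + s).im ≠ 0 by simpa using h.ne'))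
    have h4 := arg_lt_pi_iff.2 (Or.inr (show (w - s).im ≠ 0 by simpa using h.ne'))
    rw [abs_lt]
    constructor <;> linarith

lemma exp_half_log_sq {z : ℂ} (hz : z ≠ 0) : exp (1 / 2 * log z) ^ 2 = z := by
  rw [← exp_nat_mul, show ((2 : ℕ) : ℂ) * (1 / 2 * log z) = log z by push_cast; ring, exp_log hz]

lemma re_exp_half_log_pos {z : ℂ} (hz : z ∈ slitPlane) : 0 < (exp (1 / 2 * log z)).re := by
  have h1 := neg_pi_lt_arg z
  have h2 := (arg_le_pi z).lt_of_ne (mem_slitPlane_iff_arg.1 hz).1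
  rw [exp_re]
  refine mul_pos (Real.exp_pos _) (Real.cos_pos_of_mem_Ioo ⟨?_, ?_⟩) <;>
  · simp [log_im]
    linarith

lemma exp_half_log_add_half_log {w : ℂ} {s : ℝ} (hs : 0 ≤ s) (hw : s < ‖w‖) :
    exp (1 / 2 * log (w + s) + 1 / 2 * log (w - s)) =
      w * exp (1 / 2 * log (1 - s ^ 2 / w ^ 2)) := by
  have hw0 : w ≠ 0 := norm_pos_iff.1 (hs.trans_lt hw)
  have hp0 : w + s ≠ 0 := fun h => by
    rw [eq_neg_of_add_eq_zero_left h] at hw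
    simp [abs_of_nonneg hs] at hw
  have hm0 : w - s ≠ 0 := fun h => by
    rw [sub_eq_zero.1 h] at hw
    simp [abs_of_nonneg hs] at hw
  have hslit : 1 - (s : ℂ) ^ 2 / w ^ 2 ∈ slitPlane := by
    rw [sub_eq_add_neg]
    refine mem_slitPlane_of_norm_lt_one ?_
    rw [norm_neg, norm_div, norm_pow, norm_pow, norm_real, Real.norm_of_nonneg hs,
      div_lt_one (by positivity)]
    gcongr
  have hQ := exp_half_log_sq (slitPlane_ne_zero hslit)
  have hQre := re_exp_half_log_pos hslit
  have hpre : 0 < (exp (1 / 2 * log (w + s)) * (starRingEnd ℂ) (exp (1 / 2 * log (w - s)))).re := by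
    rw [← exp_conj, ← exp_add, exp_re]
    refine mul_pos (Real.exp_pos _) (Real.cos_pos_of_mem_Ioo ⟨?_, ?_⟩) <;>
    · have := abs_lt.1 (abs_arg_add_sub_arg_sub_lt_pi hs hw)
      simp [log_im]
      linarith
  have hp := exp_half_log_sq hp0
  have hm := exp_half_log_sq hm0
  rw [exp_add]
  set p := exp (1 / 2 * log (w + s))
  set m := exp (1 / 2 * log (w - s))
  set Q := exp (1 / 2 * log (1 - s ^ 2 / w ^ 2))
  have hfac : (p * m - w * Q) * (p * m + w * Q) = 0 := by
    have : w ^ 2 * Q ^ 2 = w ^ 2 - s ^ 2 := by rw [hQ]; field_simp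
    linear_combination (w - s) * hp + p ^ 2 * hm - this
  rcases mul_eq_zero.1 hfac with h | h
  · exact sub_eq_zero.1 h
  · exfalso
    have hEQ : p * m = -(w * Q) := eq_neg_of_add_eq_zero_left h
    have hre : (p * m * (starRingEnd ℂ) w).re =
        (normSq p + normSq m) / 2 * (p * (starRingEnd ℂ) m).re := by
      have hw2 : w = (p ^ 2 + m ^ 2) / 2 := by linear_combination -(hp + hm) / 2
      have hwre := congrArg re hw2
      have hwim := congrArg im hw2
      simp only [pow_two, div_ofNat_re, div_ofNat_im, add_re, add_im, mul_re, mul_im] at hwre hwim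
      simp only [normSq_apply, mul_re, mul_im, conj_re, conj_im, hwre, hwim]
      ring
    have hneg : (p * m * (starRingEnd ℂ) w).re = -(normSq w * Q.re) := by
      rw [hEQ, show -(w * Q) * (starRingEnd ℂ) w = -(w * (starRingEnd ℂ) w * Q) by ring, mul_conj,
        neg_re, re_ofReal_mul]
    have h1 : 0 < normSq w * Q.re := mul_pos (normSq_pos.2 hw0) hQre
    have h2 : 0 ≤ (normSq p + normSq m) / 2 * (p * (starRingEnd ℂ) m).re :=
      mul_nonneg (by linarith [normSq_nonneg p, normSq_nonneg m]) hpre.le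
    linarith

section SquareRootBranch

variable {a : ℝ} {ω : ℂ}

lemma cOf_pos (ha0 : 0 < a) : 0 < cOf a := by unfold cOf; positivity

lemma two_mul_cOf_lt_one (ha1 : a < 1) : 2 * cOf a < 1 := by
  unfold cOf
  rw [← mul_div_assoc, div_lt_one (by positivity)]
  nlinarith [sq_pos_of_pos (sub_pos.2 ha1)]

lemma ofReal_sqrt_two_mul_cOf_sq (ha0 : 0 < a) : (Real.sqrt (2 * cOf a) : ℂ) ^ 2 = 2 * cOf a := by
  rw [← ofReal_pow, Real.sq_sqrt (by linarith [cOf_pos ha0])]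
  push_cast
  ring

lemma ofReal_sqrt_two_mul_cOf_ne_zero (ha0 : 0 < a) : (Real.sqrt (2 * cOf a) : ℂ) ≠ 0 :=
  ofReal_ne_zero.2 (Real.sqrt_pos.2 (by linarith [cOf_pos ha0])).ne'

lemma one_add_two_mul_cOf_div_sq_mem_slitPlane (ha0 : 0 < a) (ha1 : a < 1) (hω : 1 ≤ ‖ω‖) :
    1 + 2 * (cOf a : ℂ) / ω ^ 2 ∈ slitPlane := by
  refine mem_slitPlane_of_norm_lt_one ?_
  have hc := cOf_pos ha0
  have hc1 := two_mul_cOf_lt_one ha1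
  have h2c : ‖2 * (cOf a : ℂ)‖ = 2 * cOf a := by simp [abs_of_pos hc]
  rw [norm_div, norm_pow, h2c, div_lt_one (by positivity)]
  nlinarith

/-- Off the unit disc `√(ω² + 2c) = ω √(1 + 2c/ω²)` with the principal square root. -/
lemma sqBr_eq_mul_exp (ha0 : 0 < a) (ha1 : a < 1) (hω : 1 ≤ ‖ω‖) :
    sqBr a ω = ω * exp (1 / 2 * log (1 + 2 * (cOf a : ℂ) / ω ^ 2)) := by
  have hs1 : Real.sqrt (2 * cOf a) < 1 :=
    (Real.sqrt_lt' one_pos).2 (by simpa using two_mul_cOf_lt_one ha1)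
  have h := exp_half_log_add_half_log (w := -I * ω) (Real.sqrt_nonneg (2 * cOf a))
    (by simpa using hs1.trans_le hω)
  rw [ofReal_sqrt_two_mul_cOf_sq ha0] at h
  set s : ℂ := (Real.sqrt (2 * cOf a) : ℂ) with hs
  have e1 : -I * (ω + I * s) = -I * ω + s := by linear_combination -s * I_mul_I
  have e2 : -I * (ω - I * s) = -I * ω - s := by linear_combination s * I_mul_I
  have e3 : 1 - 2 * (cOf a : ℂ) / (-I * ω) ^ 2 = 1 + 2 * (cOf a : ℂ) / ω ^ 2 := by
    rw [mul_pow, neg_sq, I_sq, neg_one_mul, div_neg, sub_neg_eq_add]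
  rw [sqBr, Lbr, Lbr, ← hs, e1, e2]
  rw [e3] at h
  rw [show (1 / 2 : ℂ) * (log (-I * ω + s) + I * (Real.pi / 2)) +
      1 / 2 * (log (-I * ω - s) + I * (Real.pi / 2)) =
      Real.pi / 2 * I + (1 / 2 * log (-I * ω + s) + 1 / 2 * log (-I * ω - s)) by ring,
    exp_add, h, exp_pi_div_two_mul_I]
  linear_combination -(ω * exp (1 / 2 * log (1 + 2 * (cOf a : ℂ) / ω ^ 2))) * I_mul_I

lemma sqBr_sq (ha0 : 0 < a) (ha1 : a < 1) (hω : 1 ≤ ‖ω‖) : sqBr a ω ^ 2 = ω ^ 2 + 2 * cOf a := by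
  have h0 : ω ≠ 0 := norm_pos_iff.1 (by linarith)
  rw [sqBr_eq_mul_exp ha0 ha1 hω, mul_pow,
    exp_half_log_sq (slitPlane_ne_zero (one_add_two_mul_cOf_div_sq_mem_slitPlane ha0 ha1 hω))]
  field_simp

lemma sqBr_ne_zero : sqBr a ω ≠ 0 := exp_ne_zero _

lemma add_sqBr_mul_Gbr (ha0 : 0 < a) (ha1 : a < 1) (hω : 1 ≤ ‖ω‖) :
    (ω + sqBr a ω) * Gbr a ω = -(Real.sqrt (2 * cOf a) : ℂ) := by
  have hs := ofReal_sqrt_two_mul_cOf_ne_zero ha0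
  rw [Gbr, mul_div_assoc', div_eq_iff hs]
  linear_combination -sqBr_sq ha0 ha1 hω + ofReal_sqrt_two_mul_cOf_sq ha0

lemma Gbr_ne_zero (ha0 : 0 < a) (ha1 : a < 1) (hω : 1 ≤ ‖ω‖) : Gbr a ω ≠ 0 := by
  intro h
  have := add_sqBr_mul_Gbr ha0 ha1 hω
  rw [h, mul_zero] at this
  exact neg_ne_zero.2 (ofReal_sqrt_two_mul_cOf_ne_zero ha0) this.symm

lemma Gbr_inv (ha0 : 0 < a) (ha1 : a < 1) (hω : 1 ≤ ‖ω‖) :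
    (Gbr a ω)⁻¹ = -(ω + sqBr a ω) / (Real.sqrt (2 * cOf a) : ℂ) := by
  have hs := ofReal_sqrt_two_mul_cOf_ne_zero ha0
  rw [inv_eq_one_div, div_eq_div_iff (Gbr_ne_zero ha0 ha1 hω) hs]
  linear_combination add_sqBr_mul_Gbr ha0 ha1 hω

lemma differentiableAt_sqBr (ha0 : 0 < a) (ha1 : a < 1) (hω : 1 < ‖ω‖) :
    DifferentiableAt ℂ (sqBr a) ω := by
  have h0 : ω ≠ 0 := norm_pos_iff.1 (by linarith)
  have heq : (fun z => z * exp (1 / 2 * log (1 + 2 * (cOf a : ℂ) / z ^ 2))) =ᶠ[𝓝 ω] sqBr a := by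
    filter_upwards [continuous_norm.continuousAt.eventually (lt_mem_nhds hω)] with z hz
    exact (sqBr_eq_mul_exp ha0 ha1 hz.le).symm
  refine heq.differentiableAt_iff.1 ?_
  have hslit := one_add_two_mul_cOf_div_sq_mem_slitPlane ha0 ha1 hω.le
  have h2 : ω ^ 2 ≠ 0 := pow_ne_zero 2 h0
  fun_prop (disch := assumption)

lemma differentiableAt_Gbr (ha0 : 0 < a) (ha1 : a < 1) (hω : 1 < ‖ω‖) :
    DifferentiableAt ℂ (Gbr a) ω :=
  (differentiableAt_id.sub (differentiableAt_sqBr ha0 ha1 hω)).div_const _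

lemma tendsto_sqBr_div (ha0 : 0 < a) (ha1 : a < 1) :
    Tendsto (fun z => sqBr a z / z) (cobounded ℂ) (𝓝 1) := by
  have hlim : Tendsto (fun z : ℂ => 1 + 2 * (cOf a : ℂ) * z⁻¹ ^ 2) (cobounded ℂ) (𝓝 1) := by
    simpa using ((tendsto_inv₀_cobounded (α := ℂ)).pow 2 |>.const_mul (2 * (cOf a : ℂ))).const_add 1
  have hc : ContinuousAt (fun u : ℂ => exp (1 / 2 * log u)) 1 :=
    (continuousAt_const.mul (continuousAt_clog one_mem_slitPlane)).cexp
  have h := hc.tendsto.comp hlim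
  simp only [log_one, mul_zero, exp_zero] at h
  refine h.congr' ?_
  filter_upwards [tendsto_norm_cobounded_atTop.eventually (eventually_ge_atTop 1)] with z hz
  have h0 : z ≠ 0 := norm_pos_iff.1 (by linarith)
  rw [sqBr_eq_mul_exp ha0 ha1 hz, mul_div_cancel_left₀ _ h0, Function.comp_apply, inv_pow,
    ← div_eq_mul_inv]

lemma tendsto_div_one_sub_mul (u : ℂ) (hu : u ≠ 0) :
    Tendsto (fun z : ℂ => z / (1 - u * z)) (cobounded ℂ) (𝓝 (-u⁻¹)) := by
  have h : Tendsto (fun z : ℂ => (z⁻¹ - u)⁻¹) (cobounded ℂ) (𝓝 (-u⁻¹)) := by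
    have := ((tendsto_inv₀_cobounded (α := ℂ)).sub_const u).inv₀ (by simpa using hu)
    simpa using this
  refine h.congr' ?_
  filter_upwards [tendsto_norm_cobounded_atTop.eventually (eventually_ge_atTop 1)] with z hz
  have h0 : z ≠ 0 := norm_pos_iff.1 (by linarith)
  rw [← inv_div, sub_div, mul_div_cancel_right₀ _ h0, one_div]

lemma tendsto_inv_Gbr_div_sqBr (ha0 : 0 < a) (ha1 : a < 1) :
    Tendsto (fun z => (Gbr a z)⁻¹ / sqBr a z) (cobounded ℂ)
      (𝓝 (-2 / (Real.sqrt (2 * cOf a) : ℂ))) := by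
  have h := (((tendsto_sqBr_div ha0 ha1).inv₀ one_ne_zero).add_const 1).neg.div_const
    (Real.sqrt (2 * cOf a) : ℂ)
  rw [inv_one, one_add_one_eq_two] at h
  refine h.congr' ?_
  filter_upwards [tendsto_norm_cobounded_atTop.eventually (eventually_ge_atTop 1)] with z hz
  have hf : sqBr a z ≠ 0 := sqBr_ne_zero
  rw [Gbr_inv ha0 ha1 hz]
  field_simp

lemma tendsto_Gbr (ha0 : 0 < a) (ha1 : a < 1) : Tendsto (Gbr a) (cobounded ℂ) (𝓝 0) := by
  have h := ((tendsto_inv₀_cobounded (α := ℂ)).mul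
    (((tendsto_sqBr_div ha0 ha1).const_add 1).inv₀ (by norm_num))).const_mul
      (-(Real.sqrt (2 * cOf a) : ℂ))
  rw [zero_mul, mul_zero] at h
  refine h.congr' ?_
  filter_upwards [tendsto_norm_cobounded_atTop.eventually (eventually_ge_atTop 1)] with z hz
  have h0 : z ≠ 0 := norm_pos_iff.1 (by linarith)
  have hne : z + sqBr a z ≠ 0 := fun h => by
    have := add_sqBr_mul_Gbr ha0 ha1 hz
    rw [h, zero_mul] at this
    exact neg_ne_zero.2 (ofReal_sqrt_two_mul_cOf_ne_zero ha0) this.symm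
  rw [← mul_inv, mul_add, mul_one, mul_div_cancel₀ _ h0, ← div_eq_mul_inv, div_eq_iff hne,
    mul_comm (Gbr a z), add_sqBr_mul_Gbr ha0 ha1 hz]

lemma one_sub_mul_ne_zero {u z : ℂ} (hu : 1 < ‖u‖) (hz : 1 < ‖z‖) : 1 - u * z ≠ 0 := by
  intro h
  have := congrArg norm (sub_eq_zero.1 h)
  rw [norm_one, norm_mul] at this
  nlinarith

lemma differentiableAt_Gbr_zpow_div (ha0 : 0 < a) (ha1 : a < 1) (k : ℤ) (hω : 1 < ‖ω‖) :
    DifferentiableAt ℂ (fun z => Gbr a z ^ k / sqBr a z) ω :=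
  ((differentiableAt_Gbr ha0 ha1 hω).zpow (Or.inl (Gbr_ne_zero ha0 ha1 hω.le))).div
    (differentiableAt_sqBr ha0 ha1 hω) sqBr_ne_zero

lemma differentiableAt_Gbr_zpow_div_div (ha0 : 0 < a) (ha1 : a < 1) (k : ℤ) {u : ℂ} (hu : 1 < ‖u‖)
    (hω : 1 < ‖ω‖) : DifferentiableAt ℂ (fun z => Gbr a z ^ k / sqBr a z / (1 - u * z)) ω :=
  (differentiableAt_Gbr_zpow_div ha0 ha1 k hω).div (by fun_prop) (one_sub_mul_ne_zero hu hω)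

variable {R : ℝ} {u : ℂ}

lemma circleIntegral_Gbr_zpow_div_eq_zero (ha0 : 0 < a) (ha1 : a < 1) (hR : 1 < R) (hu : 1 < ‖u‖)
    {k : ℤ} (hk : 0 ≤ k) : (∮ z in C(0, R), Gbr a z ^ k / sqBr a z / (1 - u * z)) = 0 := by
  lift k to ℕ using hk
  rw [circleIntegral_eq_of_tendsto_mul_cobounded (A := 0) (by linarith)
    (fun z hz => differentiableAt_Gbr_zpow_div_div ha0 ha1 k hu (hR.trans_le hz)), mul_zero]
  have hu0 : u ≠ 0 := norm_pos_iff.1 (by linarith)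
  have h := (((tendsto_Gbr ha0 ha1).pow k).mul (tendsto_inv₀_cobounded (α := ℂ))).mul
    (((tendsto_sqBr_div ha0 ha1).inv₀ one_ne_zero).mul (tendsto_div_one_sub_mul u hu0))
  rw [mul_zero, zero_mul] at h
  refine h.congr' ?_
  filter_upwards [tendsto_norm_cobounded_atTop.eventually (eventually_ge_atTop 1)] with z hz
  have h0 : z ≠ 0 := norm_pos_iff.1 (by linarith)
  rw [zpow_natCast, inv_div]
  field_simp

lemma circleIntegral_inv_Gbr_div (ha0 : 0 < a) (ha1 : a < 1) (hR : 1 < R) (hu : 1 < ‖u‖) :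
    (∮ z in C(0, R), Gbr a z ^ (-1 : ℤ) / sqBr a z / (1 - u * z)) =
      2 * Real.pi * I * (2 / (Real.sqrt (2 * cOf a) : ℂ) * u⁻¹) := by
  refine circleIntegral_eq_of_tendsto_mul_cobounded (by linarith)
    (fun z hz => differentiableAt_Gbr_zpow_div_div ha0 ha1 _ hu (hR.trans_le hz)) ?_
  have hu0 : u ≠ 0 := norm_pos_iff.1 (by linarith)
  have h := (tendsto_inv_Gbr_div_sqBr ha0 ha1).mul (tendsto_div_one_sub_mul u hu0)
  rw [neg_div, neg_mul_neg] at h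
  refine h.congr fun z => ?_
  rw [zpow_neg_one]
  ring

lemma circleIntegral_inv_Gbr_div_mul_inv (ha0 : 0 < a) (ha1 : a < 1) (hR : 1 < R) :
    (∮ z in C(0, R), Gbr a z ^ (-1 : ℤ) / sqBr a z * z⁻¹) =
      2 * Real.pi * I * (-2 / (Real.sqrt (2 * cOf a) : ℂ)) := by
  refine circleIntegral_eq_of_tendsto_mul_cobounded (by linarith) (fun z hz => ?_) ?_
  · exact (differentiableAt_Gbr_zpow_div ha0 ha1 _ (hR.trans_le hz)).mul
      (differentiableAt_inv (norm_pos_iff.1 (by linarith)))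
  · refine (tendsto_inv_Gbr_div_sqBr ha0 ha1).congr' ?_
    filter_upwards [tendsto_norm_cobounded_atTop.eventually (eventually_ge_atTop 1)] with z hz
    have h0 : z ≠ 0 := norm_pos_iff.1 (by linarith)
    rw [zpow_neg_one]
    field_simp

end SquareRootBranch

/-- For every `R > 1`: (i) `S̃_R(k,ℓ) = 0` whenever `k ≥ 0` or `ℓ ≥ 0`;
(ii) `S̃_R(-1,-1) = 1/a`. -/
theorem statement1 (a : ℝ) (ha0 : 0 < a) (ha1 : a < 1) (R : ℝ) (hR : 1 < R) :
    (∀ k l : ℤ, (0 ≤ k ∨ 0 ≤ l) → Stilde a R k l = 0) ∧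
    Stilde a R (-1) (-1) = 1 / (a : ℂ) := by
  have hR0 : 0 ≤ R := by linarith
  have hsphere {z : ℂ} (hz : z ∈ Metric.sphere (0 : ℂ) R) : 1 < ‖z‖ := by
    rwa [mem_sphere_zero_iff_norm.1 hz]
  have hsplit (k l : ℤ) (z w : ℂ) :
      Gbr a z ^ l * Gbr a w ^ k / ((1 - z * w) * sqBr a z * sqBr a w) =
        Gbr a z ^ l / sqBr a z * (Gbr a w ^ k / sqBr a w / (1 - z * w)) := by
    simp only [div_eq_mul_inv, mul_inv]
    ring
  refine ⟨fun k l hkl => ?_, ?_⟩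
  · suffices h : (∮ z in C(0, R), ∮ w in C(0, R),
        Gbr a z ^ l * Gbr a w ^ k / ((1 - z * w) * sqBr a z * sqBr a w)) = 0 by
      rw [Stilde, h, mul_zero]
    have key {k l : ℤ} (hk : 0 ≤ k) : (∮ z in C(0, R), ∮ w in C(0, R),
        Gbr a z ^ l * Gbr a w ^ k / ((1 - z * w) * sqBr a z * sqBr a w)) = 0 := by
      refine (circleIntegral.integral_congr (g := fun _ => 0) hR0 fun z hz => ?_).trans
        (by simp [circleIntegral])
      simp only [hsplit, circleIntegral.integral_const_mul]
      rw [circleIntegral_Gbr_zpow_div_eq_zero ha0 ha1 hR (hsphere hz) hk, mul_zero]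
    rcases hkl with hk | hl
    · exact key hk
    · rw [circleIntegral_swap hR0]
      · refine Eq.trans ?_ (key (k := l) (l := k) hl)
        congr! 4 with w z
        ring
      · rintro ⟨z, w⟩ ⟨hz, hw⟩
        refine ContinuousAt.continuousWithinAt ?_
        have hz1 := hsphere hz
        have hw1 := hsphere hw
        simp only [Function.uncurry_def, hsplit]
        have h1 := (differentiableAt_Gbr_zpow_div ha0 ha1 l hz1).continuousAt.comp
          (continuousAt_fst (p := (z, w)))
        have h2 := (differentiableAt_Gbr_zpow_div ha0 ha1 k hw1).continuousAt.comp
          (continuousAt_snd (p := (z, w)))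
        exact h1.mul (h2.div (by fun_prop) (one_sub_mul_ne_zero hz1 hw1))
  · have hint : (∮ z in C(0, R), ∮ w in C(0, R),
        Gbr a z ^ (-1 : ℤ) * Gbr a w ^ (-1 : ℤ) / ((1 - z * w) * sqBr a z * sqBr a w)) =
        ∮ z in C(0, R), 2 * Real.pi * I * (2 / (Real.sqrt (2 * cOf a) : ℂ)) *
          (Gbr a z ^ (-1 : ℤ) / sqBr a z * z⁻¹) := by
      refine circleIntegral.integral_congr hR0 fun z hz => ?_
      simp only [hsplit, circleIntegral.integral_const_mul]
      rw [circleIntegral_inv_Gbr_div ha0 ha1 hR (hsphere hz)]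
      ring
    rw [Stilde, hint, circleIntegral.integral_const_mul,
      circleIntegral_inv_Gbr_div_mul_inv ha0 ha1 hR]
    have hs := ofReal_sqrt_two_mul_cOf_ne_zero ha0
    have hs2 := ofReal_sqrt_two_mul_cOf_sq ha0
    set s : ℂ := (Real.sqrt (2 * cOf a) : ℂ)
    have ha : (a : ℂ) ≠ 0 := ofReal_ne_zero.2 ha0.ne'
    have ha2 : (1 + (a : ℂ) ^ 2) ≠ 0 := by
      exact_mod_cast (show (1 + a ^ 2 : ℝ) ≠ 0 by positivity)
    have hpi : 2 * (Real.pi : ℂ) * I ≠ 0 := two_pi_I_ne_zero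
    have hsa : s ^ 2 * (1 + (a : ℂ) ^ 2) = 2 * a := by
      rw [hs2, cOf]
      push_cast
      field_simp
    rw [show -(-1 : ℤ) - -1 = (2 : ℕ) by norm_num, zpow_natCast, I_sq]
    calc _ = 2 / (s ^ 2 * (1 + (a : ℂ) ^ 2)) := by field_simp
      _ = 1 / a := by rw [hsa]; field_simp
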